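/- Let E be an extended multi-segment datum and 1 ≤ k < n with R_k(E) ≠ E, and suppose the adjacent pair (k,k+1) of E satisfies Xu's non-vanishing conditions. Then R_k(E) is again an extended multi-segment datum: the updated values l_k′ and l_{k+1}′ produced by R_k satisfy 0 ≤ l_k′ ≤ b_k/2 and 0 ≤ l_{k+1}′ ≤ b_{k+1}/2. Moreover, setting ε=(−1)^{A_k−B_k}η_kη_{k+1}: in the case [A_{k+1},B_{k+1}] ⊊ [A_k,B_k], the image of l_k′ in (ℤ/b_kℤ)/{±1} equals that of l_k+ε(b_{k+1}−2l_{k+1}); and in the case [A_k,B_k] ⊆ [A_{k+1},B_{k+1}], the image of l_{k+1}′ in (ℤ/b_{k+1}ℤ)/{±1} equals that of l_{k+1}+ε(b_k−2l_k). (The claim of Remark 3.7 of the paper, showing the two definitions of row exchange agree on non-vanishing data.) -/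

import Mathlib

/-!
Common combinatorial setting for extended multi-segments (Moeglin-Atobe theory),
following Hazeltine-Liu-Lo, "On the intersection of local Arthur packets".
Rows of symbols are 0-indexed; row labels of labeled symbols are natural numbers.
-/

namespace LocalArthur

/-- A row `([A,B], l, eta)` of a symbol (an extended segment with the bound on `l` dropped). -/
structure Row where
  A : ℚ
  B : ℚ
  l : ℚ
  eta : ℤ
deriving DecidableEq

/-- `a = A + B + 1`. -/
def Row.a (r : Row) : ℚ := r.A + r.B + 1

/-- `b = A - B + 1`. -/
def Row.b (r : Row) : ℚ := r.A - r.B + 1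

/-- A rational number is an integer. -/
def IsInt (x : ℚ) : Prop := x.den = 1

instance (x : ℚ) : Decidable (IsInt x) := by unfold IsInt; infer_instance

/-- `(-1)^x` for an integer-valued rational `x` (junk value on non-integers). -/
def m1pow (x : ℚ) : ℤ := if x.num % 2 = 0 then 1 else -1

/-- Validity of a single row: `2A, 2B ∈ ℤ`, `A - B ∈ ℕ`, `l ∈ ℤ`, `eta = ±1`. -/
def Row.IsES (r : Row) : Prop :=
  IsInt (2 * r.A) ∧ IsInt (2 * r.B) ∧ (∃ n : ℕ, r.A - r.B = (n : ℚ)) ∧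
    IsInt r.l ∧ (r.eta = 1 ∨ r.eta = -1)

/-- The segment `[A,B]` of `r` is contained in that of `s`. -/
def Row.subseg (r s : Row) : Prop := s.B ≤ r.B ∧ r.A ≤ s.A

instance (r s : Row) : Decidable (r.subseg s) := by unfold Row.subseg; infer_instance

/-- A symbol: valid rows, `A_i + B_i ≥ 0`, all `A_i` congruent mod `ℤ`, and the
listed order admissible, i.e. condition (P). -/
def IsSymbol (E : List Row) : Prop :=
  (∀ r ∈ E, r.IsES) ∧ (∀ r ∈ E, 0 ≤ r.A + r.B) ∧
    (∀ r ∈ E, ∀ s ∈ E, IsInt (r.A - s.A)) ∧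
    E.Pairwise (fun r s => ¬ (s.A < r.A ∧ s.B < r.B))

/-- An extended multi-segment datum: a symbol with `0 ≤ l_i ≤ b_i / 2`. -/
def IsEMS (E : List Row) : Prop :=
  IsSymbol E ∧ ∀ r ∈ E, 0 ≤ r.l ∧ r.l ≤ r.b / 2

/-- The listed order satisfies (P'). -/
def Pprime (E : List Row) : Prop := E.Pairwise (fun r s => r.B ≤ s.B)

/-- Equivalence of extended segments. -/
def Row.Equiv (r s : Row) : Prop :=
  r.A = s.A ∧ r.B = s.B ∧ r.l = s.l ∧ (r.eta = s.eta ∨ r.l = r.b / 2)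

/-- Rowwise equivalence of symbols. -/
def SymEquiv (E F : List Row) : Prop := List.Forall₂ Row.Equiv E F

/-- Shift of one row: `[A,B] ↦ [A+d, B+d]`. -/
def Row.sh (r : Row) (d : ℤ) : Row := { r with A := r.A + d, B := r.B + d }

/-- Add on one row: `([A,B],l) ↦ ([A+d, B-d], l+d)`. -/
def Row.addOp (r : Row) (d : ℤ) : Row :=
  { r with A := r.A + d, B := r.B - d, l := r.l + d }

/-- `sh^d` applied to every row. -/
def shAll (d : ℤ) (E : List Row) : List Row := E.map fun r => r.sh d

/-- The updated pair of rows in a row exchange of rows `r = row k` and `s = row k+1`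
(assuming one of the segments contains the other); the first component is the new row
at position `k` (the updated `s`) and the second the new row at position `k+1`
(the updated `r`). -/
def rexPair (r s : Row) : Row × Row :=
  if r.subseg s then
    -- Case `[A_k,B_k] ⊆ [A_{k+1},B_{k+1}]`
    (if m1pow (r.A - r.B) * r.eta * s.eta = 1 then
        if s.b - 2 * s.l < 2 * (r.b - 2 * r.l) then
          (⟨s.A, s.B, s.b - (s.l + (r.b - 2 * r.l)), m1pow (r.A - r.B) * s.eta⟩ : Row)
        else ⟨s.A, s.B, s.l + (r.b - 2 * r.l), m1pow (r.A - r.B + 1) * s.eta⟩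
      else ⟨s.A, s.B, s.l - (r.b - 2 * r.l), m1pow (r.A - r.B + 1) * s.eta⟩,
     ⟨r.A, r.B, r.l, m1pow (s.A - s.B) * r.eta⟩)
  else
    -- Case `[A_{k+1},B_{k+1}] ⊊ [A_k,B_k]`
    (⟨s.A, s.B, s.l, m1pow (r.A - r.B) * s.eta⟩,
     if m1pow (r.A - r.B) * r.eta * s.eta = 1 then
        if r.b - 2 * r.l < 2 * (s.b - 2 * s.l) then
          (⟨r.A, r.B, r.b - (r.l + (s.b - 2 * s.l)), m1pow (s.A - s.B) * r.eta⟩ : Row)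
        else ⟨r.A, r.B, r.l + (s.b - 2 * s.l), m1pow (s.A - s.B + 1) * r.eta⟩
      else ⟨r.A, r.B, r.l - (s.b - 2 * s.l), m1pow (s.A - s.B + 1) * r.eta⟩)

/-- Row exchange `R_k` at positions `k, k+1` (0-indexed). -/
def rex (k : ℕ) (E : List Row) : List Row :=
  match E[k]?, E[k+1]? with
  | some r, some s =>
      if r.subseg s ∨ s.subseg r then
        E.take k ++ (rexPair r s).1 :: (rexPair r s).2 :: E.drop (k + 2)
      else E
  | _, _ => E

/-- One row exchange step. -/
def ReorderStep (E F : List Row) : Prop := ∃ k, F = rex k E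

/-- Admissible reorderings: finite sequences of row exchanges. -/
def Reorder : List Row → List Row → Prop := Relation.ReflTransGen ReorderStep

/-- Coincidence up to row exchanges (in either direction) and rowwise equivalence. -/
def UpToRex (E F : List Row) : Prop :=
  ∃ G, Relation.ReflTransGen (fun X Y => ReorderStep X Y ∨ ReorderStep Y X) E G ∧
    SymEquiv G F

/-- `α_i = ∑_{j<i} (A_j + B_j + 1)`. -/
def alphaAt (E : List Row) (i : ℕ) : ℚ := ((E.take i).map Row.a).sum

/-- `β_i = ∑_{j>i} (A_j - B_j + 1)`. -/
def betaAt (E : List Row) (i : ℕ) : ℚ := ((E.drop (i + 1)).map Row.b).sum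

/-- `γ_i = ∑_{j>i} (A_j + B_j + 1)`. -/
def gammaAt (E : List Row) (i : ℕ) : ℚ := ((E.drop (i + 1)).map Row.a).sum

/-- Condition (∗) of the non-vanishing criterion. -/
def StarCond (E : List Row) : Prop :=
  ∀ i : ℕ, ∀ r : Row, E[i]? = some r →
    (IsInt r.B → 0 ≤ r.B + r.l) ∧
    (¬ IsInt r.B → r.eta = - m1pow (alphaAt E i) → (1 / 2 : ℚ) ≤ r.B + r.l) ∧
    (¬ IsInt r.B → r.eta = m1pow (alphaAt E i) → -(1 / 2 : ℚ) ≤ r.B + r.l)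

/-- Xu's non-vanishing conditions at an adjacent pair of rows `(r, s) = (row k, row k+1)`. -/
def XuPair (r s : Row) : Prop :=
  ((r.A ≤ s.A ∧ r.B ≤ s.B) →
    (m1pow (r.A - r.B) * r.eta * s.eta = 1 →
        r.B + r.l ≤ s.B + s.l ∧ r.A - r.l ≤ s.A - s.l) ∧
    (m1pow (r.A - r.B) * r.eta * s.eta = -1 → r.A - r.l < s.B + s.l)) ∧
  ((r.subseg s ∧ ¬ s.subseg r) →
    (m1pow (r.A - r.B) * r.eta * s.eta = 1 → 0 ≤ s.l - r.l ∧ s.l - r.l ≤ s.b - r.b) ∧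
    (m1pow (r.A - r.B) * r.eta * s.eta = -1 → r.b ≤ r.l + s.l)) ∧
  ((s.subseg r ∧ ¬ r.subseg s) →
    (m1pow (r.A - r.B) * r.eta * s.eta = 1 → 0 ≤ r.l - s.l ∧ r.l - s.l ≤ r.b - s.b) ∧
    (m1pow (r.A - r.B) * r.eta * s.eta = -1 → s.b ≤ r.l + s.l))

/-- Xu's non-vanishing conditions at every adjacent pair of rows. -/
def XuAll (E : List Row) : Prop := E.Chain' XuPair

/-- The non-vanishing criterion for an extended multi-segment datum. -/
def NonVanishing (E : List Row) : Prop :=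
  StarCond E ∧
    ∀ d : ℕ, (∀ r ∈ E, 0 ≤ r.B + (d : ℚ)) →
      ∀ F, Reorder (shAll d E) F → XuAll F

/-- Applicability of a union-intersection at an adjacent pair of rows. -/
def uiApplicablePair (r s : Row) : Prop :=
  r.A < s.A ∧ r.B < s.B ∧
    ((m1pow (r.A - r.B) * r.eta * s.eta = 1 ∧
        (s.A - s.l = r.A - r.l ∨ s.B + s.l = r.B + r.l)) ∨
      (m1pow (r.A - r.B) * r.eta * s.eta = -1 ∧ s.B + s.l = r.A - r.l + 1))

instance (r s : Row) : Decidable (uiApplicablePair r s) := by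
  unfold uiApplicablePair; infer_instance

/-- Type 3' of a union-intersection at an adjacent pair. -/
def uiT3 (r s : Row) : Prop :=
  r.l = 0 ∧ s.l = 0 ∧ m1pow (r.A - r.B) * r.eta * s.eta = -1

instance (r s : Row) : Decidable (uiT3 r s) := by unfold uiT3; infer_instance

/-- The pair of rows produced by a union-intersection at an adjacent applicable pair. -/
def uiPair (r s : Row) : Row × Row :=
  if m1pow (r.A - r.B) * r.eta * s.eta = 1 then
    if s.A - s.l = r.A - r.l then
      -- Case 1
      ((⟨s.A, r.B, r.l, r.eta⟩ : Row),
       (⟨r.A, s.B, s.l - (s.A - r.A), m1pow (s.A - r.A) * s.eta⟩ : Row))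
    else
      -- Case 2
      if s.A - r.A ≤ r.b - 2 * r.l then
        (⟨s.A, r.B, r.l + (s.A - r.A), r.eta⟩,
         ⟨r.A, s.B, s.l, m1pow (s.A - r.A) * s.eta⟩)
      else
        (⟨s.A, r.B, r.b - r.l, - r.eta⟩,
         ⟨r.A, s.B, s.l, m1pow (s.A - r.A) * s.eta⟩)
  else
    -- Case 3
    if s.l ≤ r.l then
      (⟨s.A, r.B, r.l, r.eta⟩, ⟨r.A, s.B, s.l, m1pow (s.A - r.A) * s.eta⟩)
    else
      (⟨s.A, r.B, r.l, r.eta⟩, ⟨r.A, s.B, r.l, m1pow (s.A - r.A + 1) * s.eta⟩)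

/-- Union-intersection at positions `k, k+1` (deleting the second new row in type 3'). -/
def uiAt (k : ℕ) (E : List Row) : List Row :=
  match E[k]?, E[k+1]? with
  | some r, some s =>
      if uiApplicablePair r s then
        if uiT3 r s then
          E.take k ++ (uiPair r s).1 :: E.drop (k + 2)
        else
          E.take k ++ (uiPair r s).1 :: (uiPair r s).2 :: E.drop (k + 2)
      else E
  | _, _ => E

/-- Minimality: no union-intersection is applicable. -/
def MinimalP (E : List Row) : Prop :=
  ∀ F, Reorder E F → ∀ k r s, F[k]? = some r → F[k+1]? = some s →
    ¬ uiApplicablePair r s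

/-- The image of a row under Atobe's dual. -/
def dualRow (E : List Row) (i : ℕ) (r : Row) : Row :=
  let α := alphaAt E i
  let β := betaAt E i
  let η₀ : ℤ := if ¬ IsInt r.B ∧ r.l = r.b / 2 then - m1pow α else r.eta
  if IsInt r.B then
    ⟨r.A, -r.B, r.l + r.B, m1pow (α + β) * η₀⟩
  else
    ⟨r.A, -r.B, r.l + r.B + ((m1pow α * η₀ : ℤ) : ℚ) / 2, - (m1pow (α + β) * η₀)⟩

/-- Atobe's dual of a symbol whose order satisfies (P'). -/
def dual (E : List Row) : List Row :=
  (E.mapIdx fun i r => dualRow E i r).reverse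

/-- Applicability of the partial dual `dual_k^+` at position `k` (0-indexed). -/
def DualPlusApplicable (E : List Row) (k : ℕ) : Prop :=
  ∃ r, E[k]? = some r ∧ r.B = 1 / 2 ∧ r.l = 0 ∧ r.eta = - m1pow (alphaAt E k) ∧
    ∀ i, i < k → ∀ s, E[i]? = some s → s.B < 1 / 2

/-- The partial dual `dual_k^+` at position `k`. -/
def dualPlus (k : ℕ) (E : List Row) : List Row :=
  match E[k]? with
  | some rk =>
      (dual ((dual E).set (E.length - 1 - k)
          ⟨rk.A, 1 / 2, 0, - m1pow (gammaAt E k)⟩)).take k ++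
        (⟨rk.A, -(1 / 2), 0, - rk.eta⟩ : Row) :: E.drop (k + 1)
  | none => E

/-- Applicability of the partial dual `dual_k^-`. -/
def DualMinusApplicable (E : List Row) (k : ℕ) : Prop :=
  DualPlusApplicable (dual E) (E.length - 1 - k)

/-- The partial dual `dual_k^-`. -/
def dualMinus (k : ℕ) (E : List Row) : List Row :=
  dual (dualPlus (E.length - 1 - k) (dual E))

/-- Maximality: `E` is not, up to row exchanges, the result of a union-intersection
applied to a non-vanishing extended multi-segment datum. -/
def Maximal (E : List Row) : Prop :=
  ¬ ∃ (E'' F : List Row) (k : ℕ) (r s : Row), IsEMS E'' ∧ NonVanishing E'' ∧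
      Reorder E'' F ∧ F[k]? = some r ∧ F[k+1]? = some s ∧ uiApplicablePair r s ∧
      UpToRex (uiAt k F) E

/-- Absolute maximality. -/
def AbsolutelyMaximal (E : List Row) : Prop := Maximal E ∧ MinimalP (dual E)

/-- The sign `(-1)^{⌊b/2⌋ + l} * eta^b` of a row. -/
def rowSign (r : Row) : ℤ :=
  (if (⌊r.b / 2⌋ + ⌊r.l⌋) % 2 = 0 then (1 : ℤ) else -1) * r.eta ^ (⌊r.b⌋.toNat)

/-- The sign product of a symbol. -/
def signProd (E : List Row) : ℤ := (E.map rowSign).prod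

/-! ### Labeled symbols: rows carry labels that travel with them under reorderings. -/

/-- A labeled row. -/
abbrev LRow := ℕ × Row

/-- The underlying list of rows of a labeled symbol. -/
def rows (L : List LRow) : List Row := L.map Prod.snd

/-- `sh_i^d`, acting on the row labeled `i`. -/
def shL (i : ℕ) (d : ℤ) (L : List LRow) : List LRow :=
  L.map fun p => if p.1 = i then (p.1, p.2.sh d) else p

/-- `add_i^d`, acting on the row labeled `i`. -/
def addL (i : ℕ) (d : ℤ) (L : List LRow) : List LRow :=
  L.map fun p => if p.1 = i then (p.1, p.2.addOp d) else p

/-- `sh^d` on a labeled symbol. -/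
def shAllL (d : ℤ) (L : List LRow) : List LRow := L.map fun p => (p.1, p.2.sh d)

/-- Row exchange at positions `k, k+1` on a labeled symbol. -/
def rexL (k : ℕ) (L : List LRow) : List LRow :=
  match L[k]?, L[k+1]? with
  | some (a, r), some (c, s) =>
      if r.subseg s ∨ s.subseg r then
        L.take k ++ (c, (rexPair r s).1) :: (a, (rexPair r s).2) :: L.drop (k + 2)
      else L
  | _, _ => L

/-- One row exchange step on labeled symbols. -/
def ReorderStepL (L M : List LRow) : Prop := ∃ k, M = rexL k L

/-- Admissible reorderings of labeled symbols. -/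
def ReorderL : List LRow → List LRow → Prop := Relation.ReflTransGen ReorderStepL

/-- Labelwise equivalence of labeled symbols. -/
def LSymEquiv (L M : List LRow) : Prop :=
  List.Forall₂ (fun p q => p.1 = q.1 ∧ Row.Equiv p.2 q.2) L M

/-- `M` coincides with `L` up to row exchanges and rowwise equivalence (labels forgotten). -/
def CoincidesUpToRex (L M : List LRow) : Prop :=
  ∃ L', Relation.ReflTransGen (fun X Y => ReorderStepL X Y ∨ ReorderStepL Y X) L L' ∧
    SymEquiv (rows L') (rows M)

/-- Union-intersection at positions `k, k+1` on a labeled symbol. -/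
def uiAtL (k : ℕ) (L : List LRow) : List LRow :=
  match L[k]?, L[k+1]? with
  | some (a, r), some (c, s) =>
      if uiApplicablePair r s then
        if uiT3 r s then
          L.take k ++ (a, (uiPair r s).1) :: L.drop (k + 2)
        else
          L.take k ++ (a, (uiPair r s).1) :: (c, (uiPair r s).2) :: L.drop (k + 2)
      else L
  | _, _ => L

/-- The relation `M = ui_{i,j}(L)`, with a constraint `P` on the adjacent pair used:
some admissible reordering `L'` of `L` puts the row labeled `i` immediately before the
row labeled `j`, `ui` is applicable there, and `M` is obtained from the result by row
exchanges restoring the original relative order of the (surviving) labels. -/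
def UIrelWith (P : Row → Row → Prop) (L : List LRow) (i j : ℕ) (M : List LRow) : Prop :=
  ∃ (L' : List LRow) (k : ℕ) (r s : Row),
    ReorderL L L' ∧ L'[k]? = some (i, r) ∧ L'[k+1]? = some (j, s) ∧
    uiApplicablePair r s ∧ P r s ∧
    ReorderL (uiAtL k L') M ∧
    M.map Prod.fst =
      (L.map Prod.fst).filter fun x => decide (x ∈ (uiAtL k L').map Prod.fst)

/-- The relation `M = ui_{i,j}(L)`. -/
def UIrel (L : List LRow) (i j : ℕ) (M : List LRow) : Prop :=
  UIrelWith (fun _ _ => True) L i j M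

/-- Atobe's dual of a labeled symbol. -/
def dualL (L : List LRow) : List LRow :=
  (L.mapIdx fun i p => (p.1, dualRow (rows L) i p.2)).reverse

/-- The partial dual `dual^+` at position `k` on a labeled symbol. -/
def dualPlusL (k : ℕ) (L : List LRow) : List LRow :=
  match L[k]? with
  | some (lab, rk) =>
      (dualL ((dualL L).set (L.length - 1 - k)
          (lab, ⟨rk.A, 1 / 2, 0, - m1pow (gammaAt (rows L) k)⟩))).take k ++
        (lab, (⟨rk.A, -(1 / 2), 0, - rk.eta⟩ : Row)) :: L.drop (k + 1)
  | none => L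

/-- Position of the row labeled `i`. -/
def posOf (L : List LRow) (i : ℕ) : ℕ := L.findIdx fun p => p.1 == i

/-- The partial dual `dual_i^+`, acting at the row labeled `i`. -/
def dualPlusLab (i : ℕ) (L : List LRow) : List LRow := dualPlusL (posOf L i) L

/-- Applicability of `dual_i^+` on a labeled symbol. -/
def DualPlusApplicableLab (i : ℕ) (L : List LRow) : Prop :=
  i ∈ L.map Prod.fst ∧ DualPlusApplicable (rows L) (posOf L i)

/-- The partial dual `dual_i^-` on a labeled symbol. -/
def dualMinusLab (i : ℕ) (L : List LRow) : List LRow := dualL (dualPlusLab i (dualL L))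

/-- Applicability of `dual_i^-` on a labeled symbol. -/
def DualMinusApplicableLab (i : ℕ) (L : List LRow) : Prop :=
  DualPlusApplicableLab i (dualL L)

/-- One basic operator step: a row exchange, a union-intersection, a composition
`dual ∘ ui_{i,j} ∘ dual`, or an inverse of one of these. -/
def BasicStep (L M : List LRow) : Prop :=
  (∃ k, M = rexL k L) ∨ (∃ k, L = rexL k M) ∨
  (∃ i j, UIrel L i j M) ∨ (∃ i j, UIrel M i j L) ∨
  (∃ i j N, UIrel (dualL L) i j N ∧ M = dualL N) ∨
  (∃ i j N, UIrel (dualL M) i j N ∧ L = dualL N)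

/-- Finite sequences of basic operators. -/
def Basic : List LRow → List LRow → Prop := Relation.ReflTransGen BasicStep

/-- Shift every row after position `j` one step to the right. -/
def shAfter (j : ℕ) (E : List Row) : List Row :=
  E.mapIdx fun i r => if j < i then r.sh 1 else r

/-- Shift every row with `B_i ≥ B` one step to the left. -/
def shiftGE (B : ℚ) (E : List Row) : List Row :=
  E.map fun r => if B ≤ r.B then r.sh (-1) else r

/-- Shift every row with `B_i ≥ 1/2` one step to the left, deleting the rows of the
form `([1/2,1/2], 0, η)`. -/
def shiftHalfDel (E : List Row) : List Row :=
  (E.filter fun r => !decide (r.A = 1 / 2 ∧ r.B = 1 / 2 ∧ r.l = 0)).map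
    fun r => if (1 / 2 : ℚ) ≤ r.B then r.sh (-1) else r

/-- The rows `([A-r, -(A-r)-1], ⌊A⌋-r, 1)` for `r = 0, …, ⌊A⌋`. -/
def prefixRows (A : ℚ) : List Row :=
  (List.range (⌊A⌋.toNat + 1)).map fun r =>
    ⟨A - r, -(A - r) - 1, (⌊A⌋ : ℚ) - r, 1⟩

theorem isInt_iff_exists {x : ℚ} : IsInt x ↔ ∃ n : ℤ, x = n :=
  ⟨fun h => ⟨x.num, (Rat.den_eq_one_iff x).mp h |>.symm⟩, by rintro ⟨n, rfl⟩; rfl⟩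

theorem m1pow_eq_one_or (x : ℚ) : m1pow x = 1 ∨ m1pow x = -1 := by
  unfold m1pow
  split_ifs <;> simp

theorem sign_mul {x y : ℤ} (hx : x = 1 ∨ x = -1) (hy : y = 1 ∨ y = -1) :
    x * y = 1 ∨ x * y = -1 := by
  rcases hx with rfl | rfl <;> rcases hy with rfl | rfl <;> simp

theorem Row.Equiv.refl (r : Row) : r.Equiv r := ⟨rfl, rfl, rfl, Or.inl rfl⟩

/-- A row exchange does not change the two segments. -/
theorem rexPair_segments (r s : Row) :
    (rexPair r s).1.A = s.A ∧ (rexPair r s).1.B = s.B ∧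
      (rexPair r s).2.A = r.A ∧ (rexPair r s).2.B = r.B := by
  unfold rexPair
  split_ifs <;> exact ⟨rfl, rfl, rfl, rfl⟩

theorem rexPair_eta {r s : Row} (hr : r.eta = 1 ∨ r.eta = -1) (hs : s.eta = 1 ∨ s.eta = -1) :
    ((rexPair r s).1.eta = 1 ∨ (rexPair r s).1.eta = -1) ∧
      ((rexPair r s).2.eta = 1 ∨ (rexPair r s).2.eta = -1) := by
  unfold rexPair
  split_ifs <;> exact ⟨sign_mul (m1pow_eq_one_or _) hs, sign_mul (m1pow_eq_one_or _) hr⟩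

theorem Row.IsES.exists_int {r : Row} (h : r.IsES) : ∃ n m : ℤ, r.b = n ∧ r.l = m := by
  obtain ⟨-, -, ⟨n, hn⟩, hl, -⟩ := h
  obtain ⟨m, hm⟩ := isInt_iff_exists.mp hl
  exact ⟨n + 1, m, by rw [Row.b, hn]; push_cast; rfl, hm⟩

theorem rexPair_l_isInt {r s : Row} (hr : r.IsES) (hs : s.IsES) :
    IsInt (rexPair r s).1.l ∧ IsInt (rexPair r s).2.l := by
  obtain ⟨b, l, hb, hl⟩ := hr.exists_int
  obtain ⟨c, m, hc, hm⟩ := hs.exists_int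
  simp only [isInt_iff_exists]
  unfold rexPair
  split_ifs <;> simp only [hb, hl, hc, hm] <;> constructor <;> exact mod_cast ⟨_, rfl⟩

/-- Xu's conditions in the case `[A_k,B_k] ⊆ [A_{k+1},B_{k+1}]`, equality allowed. -/
theorem XuPair.of_subseg {r s : Row} (h : XuPair r s) (hr : r.IsES) (hs : s.IsES)
    (hsub : r.subseg s) :
    (m1pow (r.A - r.B) * r.eta * s.eta = 1 → s.l - r.l ≤ s.b - r.b) ∧
      (m1pow (r.A - r.B) * r.eta * s.eta = -1 → r.b ≤ r.l + s.l) := by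
  by_cases hsr : s.subseg r
  · obtain ⟨hB, hA⟩ := hsub
    obtain ⟨hB', hA'⟩ := hsr
    obtain ⟨h₁, h₂⟩ := h.1 ⟨hA, hB'⟩
    refine ⟨fun he => ?_, fun he => ?_⟩
    · have := (h₁ he).2
      simp only [Row.b]
      linarith
    · have hlt := h₂ he
      obtain ⟨b, l, hb, hl⟩ := hr.exists_int
      obtain ⟨-, m, -, hm⟩ := hs.exists_int
      have hlt' : r.b < r.l + s.l + 1 := by
        simp only [Row.b]
        linarith
      rw [hb, hl, hm] at hlt' ⊢
      norm_cast at hlt' ⊢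
      omega
  · obtain ⟨h₁, h₂⟩ := h.2.1 ⟨hsub, hsr⟩
    exact ⟨fun he => (h₁ he).2, h₂⟩

theorem rexPair_l_bounds {r s : Row} (hr : r.IsES) (hs : s.IsES)
    (hrl : 0 ≤ r.l ∧ r.l ≤ r.b / 2) (hsl : 0 ≤ s.l ∧ s.l ≤ s.b / 2)
    (hsub : r.subseg s ∨ s.subseg r) (hXu : XuPair r s) :
    (0 ≤ (rexPair r s).1.l ∧ (rexPair r s).1.l ≤ s.b / 2) ∧
      (0 ≤ (rexPair r s).2.l ∧ (rexPair r s).2.l ≤ r.b / 2) := by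
  obtain ⟨hr₀, hr₁⟩ := hrl
  obtain ⟨hs₀, hs₁⟩ := hsl
  have hε := sign_mul (sign_mul (m1pow_eq_one_or (r.A - r.B)) hr.2.2.2.2) hs.2.2.2.2
  by_cases hrs : r.subseg s
  · obtain ⟨h₁, h₂⟩ := hXu.of_subseg hr hs hrs
    unfold rexPair
    rcases hε with he | he
    · have := h₁ he
      simp only [hrs, he, if_true]
      split_ifs <;> refine ⟨⟨?_, ?_⟩, ?_, ?_⟩ <;> linarith
    · have := h₂ he
      simp only [hrs, he, if_true]
      refine ⟨⟨?_, ?_⟩, ?_, ?_⟩ <;> norm_num <;> linarith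
  · obtain ⟨h₁, h₂⟩ := hXu.2.2 ⟨hsub.resolve_left hrs, hrs⟩
    unfold rexPair
    rcases hε with he | he
    · have := h₁ he
      simp only [hrs, he, if_true, if_false]
      split_ifs <;> refine ⟨⟨?_, ?_⟩, ?_, ?_⟩ <;> linarith
    · have := h₂ he
      simp only [hrs, he, if_false]
      refine ⟨⟨?_, ?_⟩, ?_, ?_⟩ <;> norm_num <;> linarith

theorem rexPair_fst_l_mod {r s : Row}
    (hε : m1pow (r.A - r.B) * r.eta * s.eta = 1 ∨ m1pow (r.A - r.B) * r.eta * s.eta = -1)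
    (hrs : r.subseg s) :
    ∃ m : ℤ,
      (rexPair r s).1.l -
          (s.l + (m1pow (r.A - r.B) * r.eta * s.eta : ℤ) * (r.b - 2 * r.l)) = m * s.b ∨
      (rexPair r s).1.l +
          (s.l + (m1pow (r.A - r.B) * r.eta * s.eta : ℤ) * (r.b - 2 * r.l)) = m * s.b := by
  unfold rexPair
  rcases hε with he | he <;> simp only [hrs, he, if_true]
  · split_ifs
    · exact ⟨1, Or.inr (by push_cast; ring)⟩
    · exact ⟨0, Or.inl (by push_cast; ring)⟩
  · exact ⟨0, Or.inl (by norm_num; ring)⟩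

theorem rexPair_snd_l_mod {r s : Row}
    (hε : m1pow (r.A - r.B) * r.eta * s.eta = 1 ∨ m1pow (r.A - r.B) * r.eta * s.eta = -1)
    (hrs : ¬ r.subseg s) :
    ∃ m : ℤ,
      (rexPair r s).2.l -
          (r.l + (m1pow (r.A - r.B) * r.eta * s.eta : ℤ) * (s.b - 2 * s.l)) = m * r.b ∨
      (rexPair r s).2.l +
          (r.l + (m1pow (r.A - r.B) * r.eta * s.eta : ℤ) * (s.b - 2 * s.l)) = m * r.b := by
  unfold rexPair
  rcases hε with he | he <;> simp only [hrs, he, if_true, if_false]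
  · split_ifs
    · exact ⟨1, Or.inr (by push_cast; ring)⟩
    · exact ⟨0, Or.inl (by push_cast; ring)⟩
  · exact ⟨0, Or.inl (by norm_num; ring)⟩

theorem eq_take_append_cons_cons_drop {α : Type*} {L : List α} {k : ℕ} {x y : α}
    (hx : L[k]? = some x) (hy : L[k + 1]? = some y) :
    L = L.take k ++ x :: y :: L.drop (k + 2) := by
  obtain ⟨hk, rfl⟩ := List.getElem?_eq_some_iff.mp hx
  obtain ⟨hk', rfl⟩ := List.getElem?_eq_some_iff.mp hy
  rw [List.getElem_cons_drop, List.getElem_cons_drop, List.take_append_drop]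

/-- Replacing two adjacent nested rows, in the opposite order, by valid rows with the same
segments preserves extended multi-segment data. -/
theorem IsEMS.swap {X Y : List Row} {r s r' s' : Row} (h : IsEMS (X ++ r :: s :: Y))
    (hsub : r.subseg s ∨ s.subseg r)
    (hr' : r'.A = r.A ∧ r'.B = r.B) (hs' : s'.A = s.A ∧ s'.B = s.B)
    (hri : IsInt r'.l) (hsi : IsInt s'.l)
    (hre : r'.eta = 1 ∨ r'.eta = -1) (hse : s'.eta = 1 ∨ s'.eta = -1)
    (hrl : 0 ≤ r'.l ∧ r'.l ≤ r'.b / 2) (hsl : 0 ≤ s'.l ∧ s'.l ≤ s'.b / 2) :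
    IsEMS (X ++ s' :: r' :: Y) := by
  obtain ⟨⟨hES, hpos, hint, hP⟩, hl⟩ := h
  obtain ⟨hrA, hrB⟩ := hr'
  obtain ⟨hsA, hsB⟩ := hs'
  have hseg : ∀ t ∈ X ++ s' :: r' :: Y,
      ∃ u ∈ X ++ r :: s :: Y, t.A = u.A ∧ t.B = u.B := by
    intro t ht
    simp only [List.mem_append, List.mem_cons] at ht
    rcases ht with ht | rfl | rfl | ht
    · exact ⟨t, by simp [ht], rfl, rfl⟩
    · exact ⟨s, by simp, hsA, hsB⟩
    · exact ⟨r, by simp, hrA, hrB⟩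
    · exact ⟨t, by simp [ht], rfl, rfl⟩
  refine ⟨⟨fun t ht => ?_, fun t ht => ?_, fun t ht u hu => ?_, ?_⟩, fun t ht => ?_⟩
  · obtain ⟨u, hu, hA, hB⟩ := hseg t ht
    obtain ⟨h₁, h₂, h₃, -, -⟩ := hES u hu
    rw [Row.IsES, hA, hB]
    refine ⟨h₁, h₂, h₃, ?_⟩
    simp only [List.mem_append, List.mem_cons] at ht
    rcases ht with ht | rfl | rfl | ht
    · exact (hES t (by simp [ht])).2.2.2
    · exact ⟨hsi, hse⟩
    · exact ⟨hri, hre⟩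
    · exact (hES t (by simp [ht])).2.2.2
  · obtain ⟨u, hu, hA, hB⟩ := hseg t ht
    rw [hA, hB]
    exact hpos u hu
  · obtain ⟨t', ht', hA, -⟩ := hseg t ht
    obtain ⟨u', hu', hA', -⟩ := hseg u hu
    rw [hA, hA']
    exact hint t' ht' u' hu'
  · have hsr : ¬ (r.A < s.A ∧ r.B < s.B) := by
      rintro ⟨hA, hB⟩
      rcases hsub with h | h
      · exact absurd h.1 (not_le.mpr hB)
      · exact absurd h.2 (not_le.mpr hA)
    simp only [List.pairwise_append, List.pairwise_cons, List.mem_cons, forall_eq_or_imp,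
      hrA, hrB, hsA, hsB] at hP ⊢
    obtain ⟨hX, ⟨⟨-, hrY⟩, hsY, hY⟩, hXY⟩ := hP
    exact ⟨hX, ⟨⟨hsr, hsY⟩, hrY, hY⟩,
      fun a ha => ⟨(hXY a ha).2.1, (hXY a ha).1, (hXY a ha).2.2⟩⟩
  · simp only [List.mem_append, List.mem_cons] at ht
    rcases ht with ht | rfl | rfl | ht
    · exact hl t (by simp [ht])
    · exact hsl
    · exact hrl
    · exact hl t (by simp [ht])

/-- Remark 3.7: if the adjacent pair `(k, k+1)` of an extended multi-segment datum
satisfies Xu's non-vanishing conditions and `R_k(E) ≠ E`, then `R_k(E)` is again an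
extended multi-segment datum, and the updated `l`-values agree, in `(ℤ/bℤ)/{±1}`,
with `l + ε(b' - 2l')`. -/
theorem rowExchange_ems_and_mod (E : List Row) (hE : IsEMS E)
    (k : ℕ) (r s : Row) (hr : E[k]? = some r) (hs : E[k+1]? = some s)
    (hne : ¬ SymEquiv (rex k E) E) (hXu : XuPair r s) :
    IsEMS (rex k E) ∧
    (0 ≤ (rexPair r s).1.l ∧ (rexPair r s).1.l ≤ (rexPair r s).1.b / 2) ∧
    (0 ≤ (rexPair r s).2.l ∧ (rexPair r s).2.l ≤ (rexPair r s).2.b / 2) ∧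
    (r.subseg s →
      ∃ m : ℤ,
        (rexPair r s).1.l -
            (s.l + (m1pow (r.A - r.B) * r.eta * s.eta : ℤ) * (r.b - 2 * r.l)) = m * s.b ∨
        (rexPair r s).1.l +
            (s.l + (m1pow (r.A - r.B) * r.eta * s.eta : ℤ) * (r.b - 2 * r.l)) = m * s.b) ∧
    (s.subseg r ∧ ¬ r.subseg s →
      ∃ m : ℤ,
        (rexPair r s).2.l -
            (r.l + (m1pow (r.A - r.B) * r.eta * s.eta : ℤ) * (s.b - 2 * s.l)) = m * r.b ∨
        (rexPair r s).2.l +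
            (r.l + (m1pow (r.A - r.B) * r.eta * s.eta : ℤ) * (s.b - 2 * s.l)) = m * r.b) := by
  have hnest : r.subseg s ∨ s.subseg r := by
    by_contra hcon
    refine hne ?_
    simp only [rex, hr, hs, if_neg hcon]
    exact List.forall₂_same.mpr fun t _ => Row.Equiv.refl t
  have hrE := List.mem_of_getElem? hr
  have hsE := List.mem_of_getElem? hs
  have hrES := hE.1.1 r hrE
  have hsES := hE.1.1 s hsE
  have hε := sign_mul (sign_mul (m1pow_eq_one_or (r.A - r.B)) hrES.2.2.2.2) hsES.2.2.2.2
  obtain ⟨h₁A, h₁B, h₂A, h₂B⟩ := rexPair_segments r s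
  obtain ⟨h₁, h₂⟩ := rexPair_l_bounds hrES hsES (hE.2 r hrE) (hE.2 s hsE) hnest hXu
  have hb₁ : (rexPair r s).1.b = s.b := by simp only [Row.b, h₁A, h₁B]
  have hb₂ : (rexPair r s).2.b = r.b := by simp only [Row.b, h₂A, h₂B]
  rw [← hb₁] at h₁
  rw [← hb₂] at h₂
  refine ⟨?_, h₁, h₂, rexPair_fst_l_mod hε, fun h => rexPair_snd_l_mod hε h.2⟩
  have hrex : rex k E = E.take k ++ (rexPair r s).1 :: (rexPair r s).2 :: E.drop (k + 2) := by
    simp only [rex, hr, hs, if_pos hnest]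
  rw [hrex]
  rw [eq_take_append_cons_cons_drop hr hs] at hE
  obtain ⟨hi₁, hi₂⟩ := rexPair_l_isInt hrES hsES
  obtain ⟨he₁, he₂⟩ := rexPair_eta hrES.2.2.2.2 hsES.2.2.2.2
  exact hE.swap hnest ⟨h₂A, h₂B⟩ ⟨h₁A, h₁B⟩ hi₂ hi₁ he₂ he₁ h₂ h₁

end LocalArthur
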